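/- Let F_n = { ⟨i, ⌈n/2⌉ + i⟩ : 1 ≤ i ≤ ⌊n/2⌋ } and let π be a permutation of {1,…,n} with π(F_n) = F_n, and let L be a layer on n channels such that π(L) is again a layer (all comparators of π(L) satisfy i < j). If there exists a sorting network with n channels and depth d whose first layer is F_n and whose second layer is L, then there exists a sorting network with n channels and depth d whose first layer is F_n and whose second layer is π(L). -/

import Mathlib

/-- A comparator on `n` channels: an ordered pair of channel indices
(the first component receives the minimum, the second the maximum). -/
abbrev Comparator (n : ℕ) : Type := Fin n × Fin n

/-- A layer of a comparator network: a list of comparators. -/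
abbrev Layer (n : ℕ) : Type := List (Comparator n)

/-- A comparator network: a list of layers; its depth is the length of this list. -/
abbrev Network (n : ℕ) : Type := List (Layer n)

/-- Two comparators are channel-disjoint if they share no channel. -/
def ChDisjoint {n : ℕ} (c d : Comparator n) : Prop :=
  c.1 ≠ d.1 ∧ c.1 ≠ d.2 ∧ c.2 ≠ d.1 ∧ c.2 ≠ d.2

/-- A valid (ordinary) layer: every comparator `⟨i,j⟩` satisfies `i < j`
and every channel occurs at most once in the layer. -/
def IsLayer {n : ℕ} (L : Layer n) : Prop :=
  (∀ c ∈ L, c.1 < c.2) ∧ L.Pairwise ChDisjoint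

/-- A valid (ordinary) comparator network: all its layers are valid layers. -/
def IsNetwork {n : ℕ} (C : Network n) : Prop := ∀ L ∈ C, IsLayer L

/-- Applying the comparator `c = ⟨i,j⟩` to a vector of values:
channel `i` receives the minimum and channel `j` the maximum of the
values on channels `i` and `j`; all other channels are unchanged. -/
def applyComparator {n : ℕ} {α : Type*} [LinearOrder α] (c : Comparator n)
    (v : Fin n → α) : Fin n → α := fun k =>
  if k = c.1 then min (v c.1) (v c.2)
  else if k = c.2 then max (v c.1) (v c.2)
  else v k

/-- Applying a layer: apply all its comparators (they act on disjoint channels). -/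
def applyLayer {n : ℕ} {α : Type*} [LinearOrder α] (L : Layer n)
    (v : Fin n → α) : Fin n → α :=
  L.foldl (fun w c => applyComparator c w) v

/-- Applying a network: apply its layers in sequence; `applyNetwork C x` is `C(x)`. -/
def applyNetwork {n : ℕ} {α : Type*} [LinearOrder α] (C : Network n)
    (v : Fin n → α) : Fin n → α :=
  C.foldl (fun w L => applyLayer L w) v

/-- `C` sorts every Boolean input: `C(x)` is sorted ascendingly for all `x ∈ {0,1}ⁿ`. -/
def Sorts {n : ℕ} (C : Network n) : Prop :=
  ∀ x : Fin n → Bool, Monotone (applyNetwork C x)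

/-- A sorting network: a valid comparator network sorting every Boolean input. -/
def IsSortingNetwork {n : ℕ} (C : Network n) : Prop := IsNetwork C ∧ Sorts C

/-- The fixed maximal first layer `F_n = { ⟨i, ⌈n/2⌉ + i⟩ : 1 ≤ i ≤ ⌊n/2⌋ }`
(here written 0-indexed: comparators `⟨i, ⌈n/2⌉ + i⟩` for `0 ≤ i < ⌊n/2⌋`). -/
def Fnet (n : ℕ) : Layer n :=
  (List.finRange n).filterMap (fun i =>
    if h : i.val < n / 2 ∧ (n + 1) / 2 + i.val < n then
      some (i, ⟨(n + 1) / 2 + i.val, h.2⟩)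
    else none)

/-- `π(L)`: replace each comparator `⟨i,j⟩` of the layer `L` by `⟨π(i),π(j)⟩`. -/
def permLayer {n : ℕ} (π : Equiv.Perm (Fin n)) (L : Layer n) : Layer n :=
  L.map (fun c => (π c.1, π c.2))

/-- The comparator on the images of the channels of `c` under `π`, oriented upwards. -/
def orientedImage {n : ℕ} (π : Equiv.Perm (Fin n)) (c : Comparator n) : Comparator n :=
  if π c.1 < π c.2 then (π c.1, π c.2) else (π c.2, π c.1)

section Comparators

variable {n : ℕ} {α : Type*} [LinearOrder α]

theorem applyComparator_eq_self {c : Comparator n} {v : Fin n → α} (h : v c.1 ≤ v c.2) :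
    applyComparator c v = v := by
  funext k
  unfold applyComparator
  split_ifs <;> simp_all

theorem applyComparator_eq_comp_swap {c : Comparator n} {v : Fin n → α} (h : v c.2 ≤ v c.1) :
    applyComparator c v = v ∘ Equiv.swap c.1 c.2 := by
  funext k
  unfold applyComparator
  simp only [Function.comp_apply, Equiv.swap_apply_def]
  split_ifs <;> simp_all

theorem exists_perm_applyComparator (c : Comparator n) (v : Fin n → α) :
    ∃ σ : Equiv.Perm (Fin n), applyComparator c v = v ∘ σ := by
  rcases le_total (v c.1) (v c.2) with h | h
  · exact ⟨1, applyComparator_eq_self h⟩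
  · exact ⟨_, applyComparator_eq_comp_swap h⟩

theorem exists_perm_applyLayer (L : Layer n) (v : Fin n → α) :
    ∃ σ : Equiv.Perm (Fin n), applyLayer L v = v ∘ σ := by
  induction L generalizing v with
  | nil => exact ⟨1, rfl⟩
  | cons c L ih =>
    obtain ⟨σ, hσ⟩ := exists_perm_applyComparator c v
    obtain ⟨τ, hτ⟩ := ih (applyComparator c v)
    exact ⟨σ * τ, hτ.trans (by rw [hσ]; rfl)⟩

theorem exists_perm_applyNetwork (C : Network n) (v : Fin n → α) :
    ∃ σ : Equiv.Perm (Fin n), applyNetwork C v = v ∘ σ := by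
  induction C generalizing v with
  | nil => exact ⟨1, rfl⟩
  | cons L C ih =>
    obtain ⟨σ, hσ⟩ := exists_perm_applyLayer L v
    obtain ⟨τ, hτ⟩ := ih (applyLayer L v)
    exact ⟨σ * τ, hτ.trans (by rw [hσ]; rfl)⟩

theorem applyLayer_eq_self_of_monotone {L : Layer n} (hL : ∀ c ∈ L, c.1 < c.2)
    {v : Fin n → α} (hv : Monotone v) : applyLayer L v = v := by
  induction L with
  | nil => rfl
  | cons c L ih =>
    have hc := applyComparator_eq_self (hv (hL c (by simp)).le)
    change applyLayer L (applyComparator c v) = v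
    rw [hc, ih fun d hd => hL d (by simp [hd])]

theorem applyNetwork_eq_self_of_monotone {C : Network n} (hC : IsNetwork C)
    {v : Fin n → α} (hv : Monotone v) : applyNetwork C v = v := by
  induction C with
  | nil => rfl
  | cons L C ih =>
    change applyNetwork C (applyLayer L v) = v
    rw [applyLayer_eq_self_of_monotone (hC L (by simp)).1 hv,
      ih fun M hM => hC M (by simp [hM])]

theorem applyComparator_comm {c d : Comparator n} (h : ChDisjoint c d) (v : Fin n → α) :
    applyComparator c (applyComparator d v) = applyComparator d (applyComparator c v) := by
  obtain ⟨h1, h2, h3, h4⟩ := h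
  funext k
  unfold applyComparator
  grind

theorem IsLayer.nodup {L : Layer n} (hL : IsLayer L) : L.Nodup :=
  hL.2.imp fun h e => h.1 (congrArg Prod.fst e)

theorem applyLayer_eq_of_perm {L M : Layer n} (hL : IsLayer L) (h : L.Perm M) (v : Fin n → α) :
    applyLayer L v = applyLayer M v := by
  refine h.foldl_eq' (fun c hc d hd w => ?_) v
  by_cases hcd : c = d
  · rw [hcd]
  · have hsymm : Std.Symm (ChDisjoint (n := n)) :=
      ⟨fun _ _ h => ⟨h.1.symm, h.2.2.1.symm, h.2.1.symm, h.2.2.2.symm⟩⟩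
    exact (applyComparator_comm (hL.2.forall hc hd hcd) w).symm

theorem applyComparator_map_perm (π : Equiv.Perm (Fin n)) (c : Comparator n) (v : Fin n → α) :
    applyComparator (π c.1, π c.2) (v ∘ π.symm) = applyComparator c v ∘ π.symm := by
  funext k
  simp [applyComparator, Equiv.symm_apply_eq]

theorem applyLayer_permLayer (π : Equiv.Perm (Fin n)) (L : Layer n) (v : Fin n → α) :
    applyLayer (permLayer π L) (v ∘ π.symm) = applyLayer L v ∘ π.symm := by
  induction L generalizing v with
  | nil => rfl
  | cons c L ih =>
    change applyLayer (permLayer π L) (applyComparator (π c.1, π c.2) (v ∘ π.symm)) = _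
    rw [applyComparator_map_perm, ih]
    rfl

theorem applyComparator_swap (i j : Fin n) (v : Fin n → α) :
    applyComparator (j, i) v = applyComparator (i, j) v ∘ Equiv.swap i j := by
  funext k
  simp only [applyComparator, Function.comp_apply, Equiv.swap_apply_def]
  grind

theorem isLayer_map_orientedImage (π : Equiv.Perm (Fin n)) {L : Layer n} (hL : IsLayer L) :
    IsLayer (L.map (orientedImage π)) := by
  refine ⟨?_, List.pairwise_map.2 (hL.2.imp fun {c d} h => ?_)⟩
  · intro c hc
    obtain ⟨d, hd, rfl⟩ := List.mem_map.1 hc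
    have hne : π d.1 ≠ π d.2 := fun e => (hL.1 d hd).ne (π.injective e)
    unfold orientedImage
    split_ifs with h
    · exact h
    · exact lt_of_le_of_ne (not_lt.1 h) hne.symm
  · obtain ⟨h1, h2, h3, h4⟩ := h
    unfold orientedImage ChDisjoint
    split_ifs <;> simp [*]

end Comparators

section Untangling

variable {n : ℕ}

theorem exists_perm_applyLayer_orientedImage (α : Type*) [LinearOrder α] (π : Equiv.Perm (Fin n))
    {L : Layer n} (hL : L.Pairwise ChDisjoint) :
    ∃ ρ : Equiv.Perm (Fin n), ∀ v : Fin n → α,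
      applyLayer (L.map (orientedImage π)) (v ∘ π.symm) = applyLayer L v ∘ ρ.symm := by
  induction L generalizing π with
  | nil => exact ⟨π, fun _ => rfl⟩
  | cons c L ih =>
    obtain ⟨hc, hL⟩ := List.pairwise_cons.1 hL
    by_cases h : π c.1 < π c.2
    · obtain ⟨ρ, hρ⟩ := ih π hL
      refine ⟨ρ, fun v => ?_⟩
      change applyLayer _ (applyComparator (orientedImage π c) _) = applyLayer L _ ∘ _
      rw [orientedImage, if_pos h, applyComparator_map_perm, hρ]
    · obtain ⟨ρ, hρ⟩ := ih (π * Equiv.swap c.1 c.2) hL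
      have hmap : L.map (orientedImage (π * Equiv.swap c.1 c.2)) = L.map (orientedImage π) := by
        refine List.map_congr_left fun d hd => ?_
        obtain ⟨h1, h2, h3, h4⟩ := hc d hd
        simp [orientedImage, Equiv.swap_apply_of_ne_of_ne h1.symm h3.symm,
          Equiv.swap_apply_of_ne_of_ne h2.symm h4.symm]
      refine ⟨ρ, fun v => ?_⟩
      change applyLayer _ (applyComparator (orientedImage π c) _) = applyLayer L _ ∘ _
      rw [orientedImage, if_neg h, applyComparator_map_perm π (c.2, c.1),
        applyComparator_swap c.1 c.2, ← hρ, hmap]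
      rfl

theorem exists_untangled_network (α : Type*) [LinearOrder α] (π : Equiv.Perm (Fin n))
    {C : Network n} (hC : IsNetwork C) :
    ∃ (D : Network n) (ρ : Equiv.Perm (Fin n)), IsNetwork D ∧ D.length = C.length ∧
      ∀ v : Fin n → α, applyNetwork D (v ∘ π.symm) = applyNetwork C v ∘ ρ.symm := by
  induction C generalizing π with
  | nil => exact ⟨[], π, hC, rfl, fun _ => rfl⟩
  | cons L C ih =>
    obtain ⟨hL, hC⟩ := List.forall_mem_cons.1 hC
    obtain ⟨σ, hσ⟩ := exists_perm_applyLayer_orientedImage α π hL.2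
    obtain ⟨D, ρ, hD, hlen, hρ⟩ := ih σ hC
    refine ⟨L.map (orientedImage π) :: D, ρ,
      List.forall_mem_cons.2 ⟨isLayer_map_orientedImage π hL, hD⟩, by simp [hlen], fun v => ?_⟩
    change applyNetwork D (applyLayer _ _) = applyNetwork C (applyLayer L v) ∘ _
    rw [hσ, hρ]

/-- An ordinary network that agrees with a sorting network up to fixed permutations of the
channels of input and output is itself a sorting network. -/
theorem Sorts.of_apply_eq_comp {C D : Network n} (hC : Sorts C) (hD : IsNetwork D)
    (π ρ : Equiv.Perm (Fin n))
    (h : ∀ x : Fin n → Bool, applyNetwork D (x ∘ π.symm) = applyNetwork C x ∘ ρ.symm) :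
    Sorts D := by
  intro x
  have hD' (y : Fin n → Bool) : applyNetwork D y = applyNetwork C (y ∘ π) ∘ ρ.symm := by
    rw [← h, Function.comp_assoc, Equiv.self_comp_symm, Function.comp_id]
  have hz : Monotone (x ∘ Tuple.sort x) := Tuple.monotone_sort x
  obtain ⟨σ, hσ⟩ := exists_perm_applyNetwork C (x ∘ π)
  obtain ⟨τ, hτ⟩ := exists_perm_applyNetwork C ((x ∘ Tuple.sort x) ∘ π)
  have hmσ : Monotone (x ∘ (π * σ : Equiv.Perm (Fin n))) := hσ ▸ hC (x ∘ π)
  have hmτ : Monotone (x ∘ (Tuple.sort x * π * τ : Equiv.Perm (Fin n))) :=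
    hτ ▸ hC ((x ∘ Tuple.sort x) ∘ π)
  have heq : applyNetwork C (x ∘ π) = applyNetwork C ((x ∘ Tuple.sort x) ∘ π) := by
    rw [hσ, hτ]
    exact Tuple.unique_monotone hmσ hmτ
  rw [hD', heq, ← hD', applyNetwork_eq_self_of_monotone hD hz]
  exact hz

end Untangling

/-- let `π` be a permutation fixing `F_n` and `L` a layer such that
`π(L)` is again a layer. If a sorting network of depth `d` with first layer `F_n` and
second layer `L` exists, then one exists with first layer `F_n` and second layer `π(L)`. -/
theorem statement_8 {n d : ℕ} (π : Equiv.Perm (Fin n))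
    (hπF : ∀ c : Comparator n, c ∈ permLayer π (Fnet n) ↔ c ∈ Fnet n)
    (L : Layer n) (hL : IsLayer L) (hπL : IsLayer (permLayer π L))
    (h : ∃ N : Network n, IsSortingNetwork (Fnet n :: L :: N) ∧
      (Fnet n :: L :: N).length = d) :
    ∃ N : Network n, IsSortingNetwork (Fnet n :: permLayer π L :: N) ∧
      (Fnet n :: permLayer π L :: N).length = d := by
  obtain ⟨N, ⟨hnet, hsort⟩, hlen⟩ := h
  have hF : IsLayer (Fnet n) := hnet _ (by simp)
  obtain ⟨D, ρ, hD, hDlen, hρ⟩ := exists_untangled_network Bool π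
    (C := N) fun M hM => hnet M (by simp [hM])
  have hinj : Function.Injective fun c : Comparator n => (π c.1, π c.2) :=
    π.injective.prodMap π.injective
  have hperm : (Fnet n).Perm (permLayer π (Fnet n)) :=
    (List.perm_ext_iff_of_nodup hF.nodup (hF.nodup.map hinj)).2 fun c => (hπF c).symm
  have hD' : IsNetwork (Fnet n :: permLayer π L :: D) :=
    List.forall_mem_cons.2 ⟨hF, List.forall_mem_cons.2 ⟨hπL, hD⟩⟩
  refine ⟨D, ⟨hD', hsort.of_apply_eq_comp hD' π ρ fun x => ?_⟩, by simpa [hDlen] using hlen⟩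
  change applyNetwork D (applyLayer (permLayer π L) (applyLayer (Fnet n) _)) =
    applyNetwork N (applyLayer L (applyLayer (Fnet n) x)) ∘ _
  rw [applyLayer_eq_of_perm hF hperm, applyLayer_permLayer, applyLayer_permLayer, hρ]
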